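/- Let Ξ be a real Hilbert space and S₁, …, S_m nonempty closed convex subsets of Ξ, at least one of which is bounded. Let w₁, …, w_m > 0 with Σᵢ wᵢ = 1, let P_i denote the projection onto S_i, and define the proximity function Φ(a) := (1/2)·Σᵢ wᵢ·dist(a, S_i)² and its set of minimizers G := {a ∈ Ξ : Φ(a) ≤ Φ(b) for all b ∈ Ξ}. Fix 0 < ε < 1 and relaxation parameters (λₙ)ₙ ⊆ [ε, 2 − ε]. Then for any a₀ ∈ Ξ, the sequence defined by a_{n+1} = aₙ + λₙ·(Σᵢ wᵢ·P_i(aₙ) − aₙ) converges weakly to a point in G. -/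

import Mathlib

open Filter

local notation "⟪" x ", " y "⟫" => @inner ℝ _ _ x y

/-- `P` is the metric (nearest-point) projection onto the set `C`. -/
def IsProjOn {H : Type*} [NormedAddCommGroup H] (P : H → H) (C : Set H) : Prop :=
  ∀ x : H, P x ∈ C ∧ ∀ y ∈ C, ‖x - P x‖ ≤ ‖x - y‖

/-- The proximity function `Φ(a) = (1/2) Σᵢ wᵢ dist(a, Sᵢ)²`. -/
noncomputable def prox {Ξ : Type*} [NormedAddCommGroup Ξ] {m : ℕ}
    (w : Fin m → ℝ) (S : Fin m → Set Ξ) (a : Ξ) : ℝ :=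
  (1 / 2) * ∑ i, w i * Metric.infDist a (S i) ^ 2

lemma proj_vi {H : Type*} [NormedAddCommGroup H] [InnerProductSpace ℝ H] {C : Set H}
    (hne : C.Nonempty) (hcv : Convex ℝ C) {P : H → H} (hP : IsProjOn P C) (x y : H) (hy : y ∈ C) :
    inner ℝ (x - P x) (y - P x) ≤ 0 := by
  have hx := hP x
  haveI : Nonempty C := hne.to_subtype
  refine (norm_eq_iInf_iff_real_inner_le_zero hcv hx.1).1 ?_ y hy
  apply le_antisymm
  · exact le_ciInf fun z => hx.2 z z.2
  · exact ciInf_le (f := fun z : C => ‖x - z‖) ⟨0, by rintro _ ⟨z, rfl⟩; exact norm_nonneg _⟩ ⟨P x, hx.1⟩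

lemma proj_infDist {H : Type*} [NormedAddCommGroup H] {C : Set H}
    (hne : C.Nonempty) {P : H → H} (hP : IsProjOn P C) (x : H) :
    Metric.infDist x C = ‖x - P x‖ := by
  apply le_antisymm
  · rw [← dist_eq_norm]; exact Metric.infDist_le_dist_of_mem (hP x).1
  · rw [Metric.le_infDist hne]
    intro y hy
    rw [dist_eq_norm]; exact (hP x).2 y hy

lemma weak_ultra {H : Type*} [NormedAddCommGroup H] [InnerProductSpace ℝ H] [CompleteSpace H]
    (a : ℕ → H) (R : ℝ) (hR : ∀ n, ‖a n‖ ≤ R) (U : Ultrafilter ℕ) :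
    ∃ g : H, ∀ y : H, Tendsto (fun n : ℕ => inner ℝ (a n) y) U (nhds (inner ℝ g y)) := by
  let f : ℕ → WeakDual ℝ H := fun n => StrongDual.toWeakDual (InnerProductSpace.toDual ℝ H (a n))
  have hc := WeakDual.isCompact_closedBall (𝕜 := ℝ) (E := H) 0 R
  obtain ⟨φ, -, hφ⟩ := hc.ultrafilter_le_nhds (U.map f) (by
    rw [le_principal_iff]
    refine Filter.univ_mem' (f := (U : Filter ℕ)) fun n => ?_
    simp only [Set.mem_preimage, Metric.mem_closedBall, dist_zero_right]
    show ‖InnerProductSpace.toDual ℝ H (a n)‖ ≤ R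
    simpa using hR n)
  refine ⟨(InnerProductSpace.toDual ℝ H).symm (WeakDual.toStrongDual φ), fun y => ?_⟩
  have h1 : Tendsto f U (nhds φ) := hφ
  have h2 := ((WeakDual.eval_continuous y).tendsto φ).comp h1
  rw [InnerProductSpace.toDual_symm_apply]
  exact h2

lemma step_lower {H : Type*} [NormedAddCommGroup H] [InnerProductSpace ℝ H] (a b p q : H)
    (h : inner ℝ (a - p) (q - p) ≤ 0) :
    (1/2) * ‖a - p‖ ^ 2 + inner ℝ (a - p) (b - a) ≤ (1/2) * ‖b - q‖ ^ 2 := by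
  have e : b - q = (a - p) + ((b - a) - (q - p)) := by abel
  have e2 := norm_add_sq_real (a - p) ((b - a) - (q - p))
  rw [← e, inner_sub_right] at e2
  nlinarith [sq_nonneg ‖(b - a) - (q - p)‖]

lemma step_upper {H : Type*} [NormedAddCommGroup H] [InnerProductSpace ℝ H] (a b p q : H)
    (h : ‖b - q‖ ≤ ‖b - p‖) :
    (1/2) * ‖b - q‖ ^ 2 ≤ (1/2) * ‖a - p‖ ^ 2 + inner ℝ (a - p) (b - a) + (1/2) * ‖b - a‖ ^ 2 := by
  have e : b - p = (a - p) + (b - a) := by abel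
  have e2 := norm_add_sq_real (a - p) (b - a)
  rw [← e] at e2
  have := pow_le_pow_left₀ (norm_nonneg _) h 2
  linarith

lemma step_firm {H : Type*} [NormedAddCommGroup H] [InnerProductSpace ℝ H] (a g p q d : H)
    (h : inner ℝ (a - p) (q - p) ≤ 0) (h' : inner ℝ (g - q) (p - q) ≤ 0) :
    2 * inner ℝ ((a - p) - (g - q)) d - ‖d‖ ^ 2 ≤ inner ℝ ((a - p) - (g - q)) (a - g) := by
  have e : a - g = ((a - p) - (g - q)) - (q - p) := by abel
  have e1 : inner ℝ (g - q) (p - q) = - inner ℝ (g - q) (q - p) := by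
    rw [← inner_neg_right]; congr 1; abel
  have e3 : inner ℝ ((a - p) - (g - q)) (q - p) = inner ℝ (a - p) (q - p) - inner ℝ (g - q) (q - p) :=
    inner_sub_left _ _ _
  have e2 := norm_sub_sq_real ((a - p) - (g - q)) d
  have e4 : inner ℝ ((a - p) - (g - q)) (a - g) =
      ‖(a - p) - (g - q)‖ ^ 2 - inner ℝ ((a - p) - (g - q)) (q - p) := by
    conv_lhs => rw [e]
    rw [← real_inner_self_eq_norm_sq, ← inner_sub_right, ← e]
  nlinarith [sq_nonneg ‖(a - p) - (g - q) - d‖]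

lemma wsum_inner {H : Type*} [NormedAddCommGroup H] [InnerProductSpace ℝ H] {m : ℕ}
    (w : Fin m → ℝ) (hw1 : ∑ i, w i = 1) (P : Fin m → H → H) (x y : H) :
    ∑ i, w i * inner ℝ (x - P i x) y = inner ℝ (x - ∑ i, w i • P i x) y := by
  have : x - ∑ i, w i • P i x = ∑ i, w i • (x - P i x) := by
    simp only [smul_sub, Finset.sum_sub_distrib, ← Finset.sum_smul, hw1, one_smul]
  rw [this, sum_inner]
  simp only [real_inner_smul_left]

/-- Combettes: the relaxed parallel projection method converges weakly to a minimizer of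
the proximity function `Φ`, provided one of the sets is bounded. -/
theorem stmt6 {Ξ : Type*} [NormedAddCommGroup Ξ] [InnerProductSpace ℝ Ξ] [CompleteSpace Ξ]
    {m : ℕ} (S : Fin m → Set Ξ)
    (hne : ∀ i, (S i).Nonempty) (hcl : ∀ i, IsClosed (S i)) (hcv : ∀ i, Convex ℝ (S i))
    (hbdd : ∃ i, Bornology.IsBounded (S i))
    (w : Fin m → ℝ) (hw : ∀ i, 0 < w i) (hw1 : ∑ i, w i = 1)
    (P : Fin m → Ξ → Ξ) (hP : ∀ i, IsProjOn (P i) (S i))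
    (ε : ℝ) (hε0 : 0 < ε) (hε1 : ε < 1)
    (lam : ℕ → ℝ) (hlam : ∀ n, lam n ∈ Set.Icc ε (2 - ε))
    (a0 : Ξ) (a : ℕ → Ξ) (ha0 : a 0 = a0)
    (ha : ∀ n : ℕ, a (n + 1) = a n + lam n • (∑ i, w i • P i (a n) - a n)) :
    ∃ g : Ξ, (∀ u : Ξ, prox w S g ≤ prox w S u) ∧
      ∀ y : Ξ, Tendsto (fun n : ℕ => ⟪a n, y⟫) atTop (nhds ⟪g, y⟫) := by
  classical
  set T : Ξ → Ξ := fun x => ∑ i, w i • P i x with hT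
  have hsum := wsum_inner w hw1 P
  have hvi := fun i => proj_vi (hne i) (hcv i) (hP i)
  have hΦ : ∀ x, prox w S x = ∑ i, w i * ((1/2) * ‖x - P i x‖ ^ 2) := by
    intro x
    unfold prox
    rw [Finset.mul_sum]
    refine Finset.sum_congr rfl fun i _ => ?_
    rw [proj_infDist (hne i) (hP i)]; ring
  have hlow : ∀ x b, prox w S x + inner ℝ (x - T x) (b - x) ≤ prox w S b := by
    intro x b
    rw [hΦ, hΦ, ← hsum, ← Finset.sum_add_distrib]
    refine Finset.sum_le_sum fun i _ => ?_
    rw [← mul_add]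
    exact mul_le_mul_of_nonneg_left (step_lower _ _ _ _ (hvi i x _ (hP i b).1)) (hw i).le
  have hup : ∀ x b, prox w S b ≤ prox w S x + inner ℝ (x - T x) (b - x) + (1/2) * ‖b - x‖ ^ 2 := by
    intro x b
    have h1 : (1/2) * ‖b - x‖ ^ 2 = ∑ i, w i * ((1/2) * ‖b - x‖ ^ 2) := by
      rw [← Finset.sum_mul, hw1, one_mul]
    rw [h1, hΦ, hΦ, ← hsum, ← Finset.sum_add_distrib, ← Finset.sum_add_distrib]
    refine Finset.sum_le_sum fun i _ => ?_
    rw [← mul_add, ← mul_add]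
    exact mul_le_mul_of_nonneg_left (step_upper _ _ _ _ ((hP i b).2 _ (hP i x).1)) (hw i).le
  have hfirm : ∀ x g, T g = g → ‖x - T x‖ ^ 2 ≤ inner ℝ (x - T x) (x - g) := by
    intro x g hg
    have h1 : ∑ i, w i * (2 * inner ℝ ((x - P i x) - (g - P i g)) (x - T x) - ‖x - T x‖ ^ 2)
        ≤ ∑ i, w i * inner ℝ ((x - P i x) - (g - P i g)) (x - g) :=
      Finset.sum_le_sum fun i _ => mul_le_mul_of_nonneg_left
        (step_firm _ _ _ _ _ (hvi i x _ (hP i g).1) (hvi i g _ (hP i x).1)) (hw i).le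
    have h2 : ∀ y, ∑ i, w i * inner ℝ ((x - P i x) - (g - P i g)) y = inner ℝ (x - T x) y := by
      intro y
      have : ∑ i, w i * inner ℝ (g - P i g) y = 0 := by
        rw [hsum]
        show inner ℝ (g - T g) y = 0
        rw [hg, sub_self, inner_zero_left]
      simp only [inner_sub_left _ _ y, mul_sub] at this ⊢
      have h3 := hsum x y
      simp only [inner_sub_left _ _ y, mul_sub] at h3
      rw [Finset.sum_sub_distrib, this, h3, sub_zero]
    rw [h2] at h1
    have h4 : ∑ i, w i * (2 * inner ℝ ((x - P i x) - (g - P i g)) (x - T x) - ‖x - T x‖ ^ 2)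
        = 2 * inner ℝ (x - T x) (x - T x) - ‖x - T x‖ ^ 2 := by
      rw [← h2 (x - T x), Finset.mul_sum]
      simp only [mul_sub, Finset.sum_sub_distrib]
      rw [← Finset.sum_mul, hw1, one_mul]
      congr 1
      exact Finset.sum_congr rfl fun i _ => by ring
    rw [h4, real_inner_self_eq_norm_sq] at h1
    linarith
  have hfix : ∀ g, (∀ u, prox w S g ≤ prox w S u) → T g = g := by
    intro g hg
    have h1 := hup g (T g)
    have h2 := hg (T g)
    have e : T g - g = -(g - T g) := by abel
    rw [e, inner_neg_right, real_inner_self_eq_norm_sq, norm_neg] at h1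
    have h3 : ‖g - T g‖ = 0 := by
      have : ‖g - T g‖ ^ 2 ≤ 0 := by linarith
      exact pow_eq_zero_iff (two_ne_zero) |>.1 (le_antisymm this (sq_nonneg _))
    exact (sub_eq_zero.1 (norm_eq_zero.1 h3)).symm
  have hnn : ∀ x, 0 ≤ prox w S x := by
    intro x
    rw [hΦ]
    exact Finset.sum_nonneg fun i _ => mul_nonneg (hw i).le (by positivity)
  have hstep : ∀ n, a (n + 1) - a n = -(lam n • (a n - T (a n))) := by
    intro n
    rw [ha n, ← smul_neg, neg_sub, add_sub_cancel_left]
  have hdec : ∀ n, prox w S (a (n + 1)) + ε * ε / 2 * ‖a n - T (a n)‖ ^ 2 ≤ prox w S (a n) := by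
    intro n
    have h1 := hup (a n) (a (n + 1))
    rw [hstep n, inner_neg_right, norm_neg, real_inner_smul_right, real_inner_self_eq_norm_sq,
      norm_smul, mul_pow, Real.norm_eq_abs, sq_abs] at h1
    obtain ⟨h2, h3⟩ := hlam n
    have h4 : ε * ε / 2 ≤ lam n - 1/2 * lam n ^ 2 := by nlinarith
    nlinarith [mul_le_mul_of_nonneg_right h4 (sq_nonneg ‖a n - T (a n)‖)]
  have hanti : Antitone fun n => prox w S (a n) := by
    refine antitone_nat_of_succ_le fun n => ?_
    have := hdec n
    have : 0 ≤ ε * ε / 2 * ‖a n - T (a n)‖ ^ 2 := by positivity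
    linarith [hdec n]
  have hd0 : Tendsto (fun n => ‖a n - T (a n)‖) atTop (nhds 0) := by
    obtain ⟨L, hL⟩ : ∃ L, Tendsto (fun n => prox w S (a n)) atTop (nhds L) :=
      ⟨_, tendsto_atTop_ciInf hanti ⟨0, by rintro _ ⟨n, rfl⟩; exact hnn _⟩⟩
    have h1 : Tendsto (fun n => (prox w S (a n) - prox w S (a (n + 1))) / (ε * ε / 2)) atTop
        (nhds ((L - L) / (ε * ε / 2))) := (hL.sub ((tendsto_add_atTop_iff_nat 1).2 hL)).div_const _
    rw [sub_self, zero_div] at h1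
    have h2 : Tendsto (fun n => ‖a n - T (a n)‖ ^ 2) atTop (nhds 0) := by
      refine squeeze_zero (fun n => sq_nonneg _) (fun n => ?_) h1
      rw [le_div_iff₀ (by positivity)]
      linarith [hdec n]
    have h3 := h2.sqrt
    simpa [Real.sqrt_sq] using h3
  obtain ⟨R, hR⟩ : ∃ R, ∀ n, ‖a n‖ ≤ R := by
    obtain ⟨j, hj⟩ := hbdd
    obtain ⟨B, hB⟩ := hj.exists_norm_le
    refine ⟨Real.sqrt (2 * prox w S (a 0) / w j) + B, fun n => ?_⟩
    have h1 : w j * ((1/2) * ‖a n - P j (a n)‖ ^ 2) ≤ prox w S (a 0) := by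
      refine le_trans ?_ (hanti (Nat.zero_le n))
      simp only [hΦ]
      exact Finset.single_le_sum (f := fun i => w i * ((1/2) * ‖a n - P i (a n)‖ ^ 2))
        (fun i _ => mul_nonneg (hw i).le (by positivity)) (Finset.mem_univ j)
    have h2 : ‖a n - P j (a n)‖ ≤ Real.sqrt (2 * prox w S (a 0) / w j) := by
      apply Real.le_sqrt_of_sq_le
      rw [le_div_iff₀ (hw j)]
      linarith
    have h3 := hB _ (hP j (a n)).1
    have h4 := norm_le_norm_add_norm_sub' (a n) (P j (a n))
    linarith
  -- weak cluster points are minimizers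
  have hclus : ∀ (U : Ultrafilter ℕ), (U : Filter ℕ) ≤ atTop → ∀ x : Ξ,
      (∀ y : Ξ, Tendsto (fun n : ℕ => inner ℝ (a n) y) U (nhds (inner ℝ x y))) →
      ∀ u, prox w S x ≤ prox w S u := by
    intro U hU x hx u
    have h1 : Tendsto (fun n => prox w S u + ‖a n - T (a n)‖ * (‖u‖ + R)) U
        (nhds (prox w S u + 0 * (‖u‖ + R))) :=
      ((hd0.mono_left hU).mul_const _).const_add _
    have h2 : Tendsto (fun n => prox w S x + (inner ℝ (a n) (x - T x) - inner ℝ x (x - T x))) U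
        (nhds (prox w S x + (inner ℝ x (x - T x) - inner ℝ x (x - T x)))) :=
      ((hx _).sub_const _).const_add _
    rw [zero_mul, add_zero] at h1
    rw [sub_self, add_zero] at h2
    refine le_of_tendsto_of_tendsto' h2 h1 fun n => ?_
    have h3 := hlow x (a n)
    have h4 := hlow (a n) u
    rw [← inner_sub_left, real_inner_comm]
    have h5 := abs_le.1 (abs_real_inner_le_norm (a n - T (a n)) (u - a n))
    have h6 : ‖u - a n‖ ≤ ‖u‖ + R := (norm_sub_le _ _).trans (by linarith [hR n])
    have h7 := mul_le_mul_of_nonneg_left h6 (norm_nonneg (a n - T (a n)))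
    linarith [h5.1]
  have hfej : ∀ g, (∀ u, prox w S g ≤ prox w S u) →
      ∃ L, Tendsto (fun n => ‖a n - g‖ ^ 2) atTop (nhds L) := by
    intro g hg
    refine ⟨_, tendsto_atTop_ciInf (antitone_nat_of_succ_le fun n => ?_)
      ⟨0, by rintro _ ⟨n, rfl⟩; exact sq_nonneg _⟩⟩
    have e : a (n + 1) - g = (a n - g) - lam n • (a n - T (a n)) := by
      have := hstep n
      rw [sub_eq_iff_eq_add] at this
      rw [this]; abel
    rw [e, norm_sub_sq_real, real_inner_smul_right, norm_smul, mul_pow, Real.norm_eq_abs, sq_abs,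
      real_inner_comm]
    have h1 := hfirm (a n) g (hfix g hg)
    obtain ⟨h2, h3⟩ := hlam n
    have h4 := mul_le_mul_of_nonneg_left h1 (hε0.le.trans h2)
    have h5 : 0 ≤ lam n * (2 - lam n) * ‖a n - T (a n)‖ ^ 2 :=
      mul_nonneg (mul_nonneg (by linarith) (by linarith)) (sq_nonneg _)
    nlinarith
  obtain ⟨g, hg⟩ := weak_ultra a R hR (Ultrafilter.of atTop)
  have hgm := hclus _ (Ultrafilter.of_le atTop) g hg
  refine ⟨g, hgm, fun y => ?_⟩
  rw [tendsto_iff_ultrafilter]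
  intro U hU
  obtain ⟨x, hx⟩ := weak_ultra a R hR U
  have hxm := hclus U hU x hx
  obtain ⟨L, hL⟩ := hfej g hgm
  obtain ⟨L', hL'⟩ := hfej x hxm
  have hc : Tendsto (fun n => inner ℝ (a n) (x - g)) atTop
      (nhds ((L - L' - (‖g‖ ^ 2 - ‖x‖ ^ 2)) / 2)) := by
    refine (((hL.sub hL').sub_const _).div_const 2).congr fun n => ?_
    rw [norm_sub_sq_real, norm_sub_sq_real, inner_sub_right]
    ring
  have e1 := tendsto_nhds_unique (hx (x - g)) (hc.mono_left hU)
  have e2 := tendsto_nhds_unique (hg (x - g)) (hc.mono_left (Ultrafilter.of_le atTop))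
  have e3 : inner ℝ (x - g) (x - g) = 0 := by
    rw [inner_sub_left, e1, e2, sub_self]
  have e4 : x = g := sub_eq_zero.1 (inner_self_eq_zero.1 e3)
  rw [← e4]
  exact hx y
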